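/- arXiv:0801.2231 — 7 statements merged into one kernel-verified Lean document; each statement's English description precedes it below -/
import Mathlib

section
/- Let S be a finite set of sites, E a set with a distinguished reference state τ_i ∈ E for each i ∈ S, and k ≥ 1 an integer. Suppose given singleton potentials G_i : E → ℝ with G_i(τ_i) = 0, and pair potentials G_{ij} : E × E → ℝ for ordered pairs of distinct sites with G_{ji}(y,x) = G_{ij}(x,y) and G_{ij}(x,y) = 0 whenever x = τ_i or y = τ_j. Suppose that for each i ∈ S there exist functions θ_i : E^{S∖{i}} → ℝ^k, B_i : E → ℝ^k with B_i(τ_i) = 0, C_i : E → ℝ with C_i(τ_i) = 0, and D_i : E^{S∖{i}} → ℝ such that for every configuration x ∈ E^S, G_i(x_i) + Σ_{j≠i} G_{ij}(x_i, x_j) = ⟨θ_i(x^i), B_i(x_i)⟩ + C_i(x_i) + D_i(x^i), where x^i = (x_j)_{j≠i}. Assume moreover that for every i the linear span of {B_i(x) : x ∈ E} is all of ℝ^k. Then there exist vectors α_i ∈ ℝ^k (i ∈ S) and k×k real matrices β_{ij} (i ≠ j) satisfying β_{ij}ᵀ = β_{ji}, such that for all i and all x^i, θ_i(x^i) = α_i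 + Σ_{j≠i} β_{ij} B_j(x_j), and moreover G_i(x_i) = ⟨α_i, B_i(x_i)⟩ + C_i(x_i) and G_{ij}(x_i, x_j) = B_i(x_i)ᵀ β_{ij} B_j(x_j) for all x_i, x_j ∈ E. -/
open Matrix

/-- A vector is determined by its dot products with a spanning family. -/
theorem eq_of_dotProduct_eq_of_span_eq_top {n X : Type*} [Fintype n] {b : X → n → ℝ}
    (hb : Submodule.span ℝ (Set.range b) = ⊤) {v w : n → ℝ}
    (h : ∀ x, v ⬝ᵥ b x = w ⬝ᵥ b x) : v = w := by
  refine dotProduct_eq v w fun u => ?_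
  have hu : u ∈ Submodule.span ℝ (Set.range b) := hb ▸ Submodule.mem_top
  induction hu using Submodule.span_induction with
  | mem u hu => obtain ⟨x, rfl⟩ := hu; exact h x
  | zero => simp
  | add u₁ u₂ _ _ h₁ h₂ => rw [dotProduct_add, dotProduct_add, h₁, h₂]
  | smul c u _ hu => rw [dotProduct_smul, dotProduct_smul, hu]

/-- If `f y ⬝ᵥ b x = g x ⬝ᵥ b' y` for all `x`, `y` and `b` spans, then `f` is a linear function
of `b'`. -/
theorem exists_mulVec_eq_of_dotProduct_eq {n X Y : Type*} [Fintype n] [DecidableEq n]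
    {b : X → n → ℝ} (hb : Submodule.span ℝ (Set.range b) = ⊤)
    {b' : Y → n → ℝ} {f : Y → n → ℝ} {g : X → n → ℝ}
    (h : ∀ x y, f y ⬝ᵥ b x = g x ⬝ᵥ b' y) :
    ∃ M : Matrix n n ℝ, ∀ y, f y = M *ᵥ b' y := by
  have key : ∀ v : n → ℝ, ∃ w : n → ℝ, ∀ y, f y ⬝ᵥ v = w ⬝ᵥ b' y := by
    intro v
    have hv : v ∈ Submodule.span ℝ (Set.range b) := hb ▸ Submodule.mem_top
    induction hv using Submodule.span_induction with
    | mem v hv => obtain ⟨x, rfl⟩ := hv; exact ⟨g x, h x⟩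
    | zero => exact ⟨0, by simp⟩
    | add v₁ v₂ _ _ h₁ h₂ =>
      obtain ⟨w₁, h₁⟩ := h₁
      obtain ⟨w₂, h₂⟩ := h₂
      exact ⟨w₁ + w₂, fun y => by rw [dotProduct_add, add_dotProduct, h₁, h₂]⟩
    | smul c v _ hv =>
      obtain ⟨w, hw⟩ := hv
      exact ⟨c • w, fun y => by rw [dotProduct_smul, smul_dotProduct, hw]⟩
  choose w hw using key
  refine ⟨Matrix.of fun m => w (Pi.single m 1), fun y => funext fun m => ?_⟩
  simpa [mulVec] using hw (Pi.single m 1) y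

/-- Characterization theorem for multi-parameter auto-models (Hardouin–Yao):
if the pairwise potentials of a Markov random field are compatible with local
conditional distributions from a `k`-dimensional exponential family (with
potentials normalized at the reference configuration `τ`, sufficient
statistics `B i` and span condition), then the natural parameters `θ i` are
affine in the neighbouring sufficient statistics, with symmetric interaction
matrices `β i j`. -/
theorem multiparameter_automodel_characterization
    {S : Type*} [Fintype S] [DecidableEq S] {E : Type*}
    (k : ℕ) (hk : 1 ≤ k)
    (τ : S → E)
    (G : S → E → ℝ) (Gp : S → S → E → E → ℝ)
    (hGτ : ∀ i, G i (τ i) = 0)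
    (hGpsym : ∀ i j : S, i ≠ j → ∀ x y : E, Gp j i y x = Gp i j x y)
    (hGpτ : ∀ i j : S, i ≠ j → ∀ x y : E, (x = τ i ∨ y = τ j) → Gp i j x y = 0)
    (θ : (i : S) → ({j : S // j ≠ i} → E) → (Fin k → ℝ))
    (B : S → E → (Fin k → ℝ))
    (C : S → E → ℝ)
    (D : (i : S) → ({j : S // j ≠ i} → E) → ℝ)
    (hBτ : ∀ i, B i (τ i) = 0)
    (hCτ : ∀ i, C i (τ i) = 0)
    (hcond : ∀ (i : S) (x : S → E),
      G i (x i) + ∑ j ∈ Finset.univ.filter (fun j => j ≠ i), Gp i j (x i) (x j)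
        = (θ i (fun j => x j.1)) ⬝ᵥ (B i (x i)) + C i (x i) + D i (fun j => x j.1))
    (hspan : ∀ i : S, Submodule.span ℝ (Set.range (B i)) = ⊤) :
    ∃ (α : S → (Fin k → ℝ)) (β : S → S → Matrix (Fin k) (Fin k) ℝ),
      (∀ i j : S, i ≠ j → (β i j)ᵀ = β j i) ∧
      (∀ (i : S) (z : {j : S // j ≠ i} → E),
        θ i z = α i + ∑ j : {j : S // j ≠ i}, (β i j.1).mulVec (B j.1 (z j))) ∧
      (∀ (i : S) (x : E), G i x = (α i) ⬝ᵥ (B i x) + C i x) ∧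
      (∀ (i j : S), i ≠ j → ∀ (x y : E),
        Gp i j x y = (B i x) ⬝ᵥ ((β i j).mulVec (B j y))) := by
  have glue : ∀ (i : S) (u : E) (z : {j : S // j ≠ i} → E),
      G i u + ∑ j : {j : S // j ≠ i}, Gp i j.1 u (z j)
        = θ i z ⬝ᵥ B i u + C i u + D i z := by
    intro i u z
    have h := hcond i (fun j => if hj : j ≠ i then z ⟨j, hj⟩ else u)
    rw [Finset.sum_subtype (p := fun j => j ≠ i) _ (by simp)] at h
    have hz : (fun j : {j : S // j ≠ i} =>
        if hj : j.1 ≠ i then z ⟨j.1, hj⟩ else u) = z := by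
      funext j
      exact dif_pos j.2
    have hz' : ∀ j : {j : S // j ≠ i},
        (if hj : j.1 ≠ i then z ⟨j.1, hj⟩ else u) = z j := congrFun hz
    have hu : (if hj : i ≠ i then z ⟨i, hj⟩ else u) = u := dif_neg (by simp)
    simp only [hz', hu] at h
    exact h
  have hD : ∀ i z, D i z = 0 := by
    intro i z
    have h := glue i (τ i) z
    rw [Finset.sum_eq_zero fun j _ => hGpτ i j.1 j.2.symm _ _ (Or.inl rfl)] at h
    simpa [hGτ, hBτ, hCτ] using h.symm
  have hGα : ∀ i u, G i u = θ i (fun j => τ j.1) ⬝ᵥ B i u + C i u := by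
    intro i u
    have h := glue i u (fun j => τ j.1)
    rw [Finset.sum_eq_zero fun j _ => hGpτ i j.1 j.2.symm _ _ (Or.inr rfl), hD] at h
    simpa using h
  have hsum : ∀ (i : S) (u : E) (z : {j : S // j ≠ i} → E),
      ∑ j : {j : S // j ≠ i}, Gp i j.1 u (z j)
        = (θ i z - θ i (fun j => τ j.1)) ⬝ᵥ B i u := by
    intro i u z
    have h := glue i u z
    rw [hGα, hD] at h
    rw [sub_dotProduct]
    linarith
  have hpair : ∀ i j : S, ∃ φ : E → Fin k → ℝ, i ≠ j → ∀ x y,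
      Gp i j x y = φ y ⬝ᵥ B i x := by
    intro i j
    refine ⟨fun y => θ i (fun l => Function.update τ j y l.1) - θ i (fun l => τ l.1),
      fun hij x y => ?_⟩
    rw [← hsum, Finset.sum_eq_single ⟨j, hij.symm⟩]
    · simp
    · intro l _ hl
      have hl' : l.1 ≠ j := fun h => hl (Subtype.ext h)
      exact hGpτ i l.1 l.2.symm _ _ (Or.inr (Function.update_of_ne hl' _ _))
    · simp
  choose φ hφ using hpair
  have hlin : ∀ i j : S, ∃ M : Matrix (Fin k) (Fin k) ℝ, i ≠ j → ∀ y,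
      φ i j y = M *ᵥ B j y := by
    intro i j
    by_cases hij : i = j
    · exact ⟨0, fun h => absurd hij h⟩
    · obtain ⟨M, hM⟩ := exists_mulVec_eq_of_dotProduct_eq (hspan i) (f := φ i j)
        (b' := B j) (g := φ j i) fun x y => by
          rw [← hφ i j hij, ← hφ j i (Ne.symm hij), hGpsym i j hij]
      exact ⟨M, fun _ => hM⟩
  choose β hβ using hlin
  have hGpβ : ∀ i j : S, i ≠ j → ∀ x y, Gp i j x y = B i x ⬝ᵥ (β i j *ᵥ B j y) := by
    intro i j hij x y
    rw [hφ i j hij, hβ i j hij, dotProduct_comm]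
  refine ⟨fun i => θ i (fun j => τ j.1), β, ?_, ?_, hGα, hGpβ⟩
  · intro i j hij
    have hvec : ∀ x, (β i j)ᵀ *ᵥ B i x = β j i *ᵥ B i x := by
      intro x
      refine eq_of_dotProduct_eq_of_span_eq_top (hspan j) fun y => ?_
      have h := hGpsym i j hij x y
      rw [hGpβ i j hij, hGpβ j i hij.symm, dotProduct_mulVec (B i x)] at h
      rw [mulVec_transpose, ← h, dotProduct_comm]
    ext m l
    refine congrFun (eq_of_dotProduct_eq_of_span_eq_top (hspan i)
      (v := (β i j)ᵀ m) (w := β j i m) fun x => ?_) l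
    exact congrFun (hvec x) m
  · intro i z
    rw [← sub_eq_iff_eq_add']
    refine eq_of_dotProduct_eq_of_span_eq_top (hspan i) fun x => ?_
    rw [← hsum, sum_dotProduct]
    refine Finset.sum_congr rfl fun j _ => ?_
    rw [hGpβ i j.1 j.2.symm, dotProduct_comm]
end

section
/- Let S be a finite set of sites equipped with a symmetric, irreflexive neighbour relation ⟨i,j⟩. Let real parameters a_i, b_i (i ∈ S) and, for each ordered neighbour pair (i,j), reals c_{ij}, d_{ij}, f_{ij}, e_{ij} with the symmetry constraints c_{ij} = c_{ji}, e_{ij} = e_{ji}, d_{ij} = f_{ji} be given. Define the energy Q : [0,∞)^S → ℝ by Q(x) = Σ_{i∈S} (a_i δ*(x_i) − b_i x_i) + Σ_{{i,j} unordered neighbour pairs} ( c_{ij} δ*(x_i)δ*(x_j) − d_{ij} δ*(x_i) x_j − f_{ij} x_i δ*(x_j) + e_{ij} x_i x_j ). Assume Conditions (A): (i) e_{ij} ≤ 0 for every neighbour pair, and (ii) for every i ∈ S and every subset A of the neighbours of i, b_i + Σ_{j∈A} f_{ij} > 0. Then ∫_{[0,∞)^S} exp(Q(x)) m^{⊗S}(dx)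 < ∞, where m is the measure on [0,∞) given by m = δ_0 + λ, the sum of the Dirac measure at 0 and Lebesgue measure on (0,∞). -/
open MeasureTheory Real

/-- `dstar x` is the indicator of nonzero values: `δ*(x) = 1` if `x ≠ 0`, `δ*(0) = 0`. -/
noncomputable def dstar (x : ℝ) : ℝ := if x = 0 then 0 else 1

/-- Every exponential `exp (-β x)` with `0 < β` is integrable for the mixed reference measure. -/
lemma integrable_exp_neg_mul_dirac_add_volume {β : ℝ} (hβ : 0 < β) :
    Integrable (fun t : ℝ => Real.exp (-β * t))
      (Measure.dirac 0 + volume.restrict (Set.Ioi 0)) :=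
  (integrable_dirac (by simp)).add_measure (exp_neg_integrableOn_Ioi 0 hβ)

lemma ae_nonneg_dirac_add_volume :
    ∀ᵐ t : ℝ ∂(Measure.dirac 0 + volume.restrict (Set.Ioi 0)), 0 ≤ t := by
  rw [ae_add_measure_iff]
  refine ⟨by simp [ae_dirac_eq], ?_⟩
  filter_upwards [ae_restrict_mem measurableSet_Ioi] with t ht using le_of_lt ht

lemma dstar_nonneg (x : ℝ) : 0 ≤ dstar x := by
  unfold dstar; split_ifs <;> norm_num

lemma dstar_le_one (x : ℝ) : dstar x ≤ 1 := by
  unfold dstar; split_ifs <;> norm_num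

/-- Finitely many positive lower rates admit a common positive lower bound. -/
lemma exists_pos_le_add_sum_of_subset {S : Type*} (s : Finset S) (b : ℝ) (f : S → ℝ)
    (h : ∀ A ⊆ s, 0 < b + ∑ j ∈ A, f j) :
    ∃ β, 0 < β ∧ ∀ A ⊆ s, β ≤ b + ∑ j ∈ A, f j := by
  obtain ⟨A, hA, hmin⟩ := s.powerset.exists_min_image (fun A => b + ∑ j ∈ A, f j)
    ⟨∅, Finset.empty_mem_powerset s⟩
  exact ⟨_, h A (Finset.mem_powerset.1 hA), fun B hB => hmin B (Finset.mem_powerset.2 hB)⟩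

lemma sum_mul_dstar {S : Type*} (s : Finset S) (f x : S → ℝ) :
    ∑ j ∈ s, f j * dstar (x j) = ∑ j ∈ s with x j ≠ 0, f j := by
  rw [Finset.sum_filter]
  refine Finset.sum_congr rfl fun j _ => ?_
  by_cases h : x j = 0 <;> simp [dstar, h]

/-- Summing over ordered related pairs, the two coordinates may be exchanged. -/
lemma sum_filter_comm_of_symm {S : Type*} [Fintype S] (N : S → S → Prop) [DecidableRel N]
    (hN : ∀ i j, N i j → N j i) (g : S → S → ℝ) :
    ∑ i, ∑ j with N i j, g i j = ∑ i, ∑ j with N i j, g j i :=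
  Finset.sum_comm' fun i j => by simpa using ⟨hN i j, hN j i⟩

/-- Well-definedness of the auto-model with mixed exponential conditional
distributions: under Conditions (A), the Gibbs density `exp ∘ Q` is integrable
with respect to the product of the mixture reference measures `m = δ₀ + Leb|(0,∞)`.
The sum over unordered neighbour pairs is written as half the sum over ordered
neighbour pairs (legitimate since the summand is, by the symmetry constraints
on the parameters, symmetric in `(i,j)`). -/
theorem mixed_exponential_automodel_integrable
    {S : Type*} [Fintype S] [DecidableEq S]
    (N : S → S → Prop) [DecidableRel N]
    (hNsym : ∀ i j, N i j → N j i) (hNirr : ∀ i, ¬ N i i)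
    (a b : S → ℝ) (c d f e : S → S → ℝ)
    (hc : ∀ i j, N i j → c i j = c j i)
    (he : ∀ i j, N i j → e i j = e j i)
    (hdf : ∀ i j, N i j → d i j = f j i)
    -- Condition (A)(i)
    (hA1 : ∀ i j, N i j → e i j ≤ 0)
    -- Condition (A)(ii)
    (hA2 : ∀ (i : S) (A : Finset S), (∀ j ∈ A, N i j) → 0 < b i + ∑ j ∈ A, f i j)
    (Q : (S → ℝ) → ℝ)
    (hQ : ∀ x : S → ℝ,
      Q x = ∑ i, (a i * dstar (x i) - b i * x i)
        + (1 / 2) * ∑ i, ∑ j ∈ Finset.univ.filter (fun j => N i j),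
            (c i j * dstar (x i) * dstar (x j) - d i j * dstar (x i) * x j
              - f i j * x i * dstar (x j) + e i j * x i * x j)) :
    ∫⁻ x : S → ℝ, ENNReal.ofReal (Real.exp (Q x))
      ∂(Measure.pi fun _ : S => (Measure.dirac 0 + volume.restrict (Set.Ioi 0)))
        < ⊤ := by
  choose β hβ hβle using fun i => exists_pos_le_add_sum_of_subset
    (Finset.univ.filter (fun j => N i j)) (b i) (f i)
    fun A hA => hA2 i A fun j hj => by simpa using hA hj
  set C : ℝ := ∑ i, |a i| + (1 / 2) * ∑ i, ∑ j with N i j, |c i j| with hC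
  have abs_bound (u t : ℝ) (h0 : 0 ≤ t) (h1 : t ≤ 1) : u * t ≤ |u| :=
    (mul_le_mul_of_nonneg_right (le_abs_self u) h0).trans
      (mul_le_of_le_one_right (abs_nonneg u) h1)
  have energy_le (x : S → ℝ) (hx : ∀ i, 0 ≤ x i) : Q x ≤ C + ∑ i, -β i * x i := by
    have hswap : ∑ i, ∑ j with N i j, d i j * dstar (x i) * x j
        = ∑ i, ∑ j with N i j, f i j * x i * dstar (x j) := by
      rw [sum_filter_comm_of_symm N hNsym]
      refine Finset.sum_congr rfl fun i _ => Finset.sum_congr rfl fun j hj => ?_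
      rw [hdf j i (hNsym i j (by simpa using hj))]
      ring
    have hcross : ∑ i, ∑ j with N i j, f i j * x i * dstar (x j)
        = ∑ i, x i * ∑ j ∈ Finset.univ.filter (fun j => N i j) with x j ≠ 0, f i j := by
      refine Finset.sum_congr rfl fun i _ => ?_
      rw [← sum_mul_dstar, Finset.mul_sum]
      exact Finset.sum_congr rfl fun j _ => by ring
    have hrate : ∑ i, -(b i * x i)
        - ∑ i, x i * ∑ j ∈ Finset.univ.filter (fun j => N i j) with x j ≠ 0, f i j
        ≤ ∑ i, -β i * x i := by
      rw [← Finset.sum_sub_distrib]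
      refine Finset.sum_le_sum fun i _ => ?_
      have := mul_le_mul_of_nonneg_right (hβle i _ (Finset.filter_subset (fun j => x j ≠ 0) _))
        (hx i)
      linarith
    have ha : ∑ i, a i * dstar (x i) ≤ ∑ i, |a i| :=
      Finset.sum_le_sum fun i _ => abs_bound _ _ (dstar_nonneg _) (dstar_le_one _)
    have hcc : ∑ i, ∑ j with N i j, c i j * dstar (x i) * dstar (x j)
        ≤ ∑ i, ∑ j with N i j, |c i j| :=
      Finset.sum_le_sum fun i _ => Finset.sum_le_sum fun j _ => by
        rw [mul_assoc]
        exact abs_bound _ _ (mul_nonneg (dstar_nonneg _) (dstar_nonneg _))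
          (mul_le_one₀ (dstar_le_one _) (dstar_nonneg _) (dstar_le_one _))
    have hee : ∑ i, ∑ j with N i j, e i j * x i * x j ≤ 0 :=
      Finset.sum_nonpos fun i _ => Finset.sum_nonpos fun j hj =>
        mul_nonpos_of_nonpos_of_nonneg
          (mul_nonpos_of_nonpos_of_nonneg (hA1 i j (by simpa using hj)) (hx i)) (hx j)
    rw [hQ]
    simp only [Finset.sum_add_distrib, Finset.sum_sub_distrib]
    rw [hswap, hcross]
    rw [Finset.sum_neg_distrib] at hrate
    linarith
  have hint : Integrable (fun x : S → ℝ => Real.exp C * ∏ i, Real.exp (-β i * x i))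
      (Measure.pi fun _ : S => (Measure.dirac 0 + volume.restrict (Set.Ioi 0))) :=
    (Integrable.fintype_prod fun i => integrable_exp_neg_mul_dirac_add_volume (hβ i)).const_mul _
  refine (lintegral_mono_ae ?_).trans_lt hint.lintegral_lt_top
  have hnonneg : ∀ᵐ x : S → ℝ
      ∂(Measure.pi fun _ : S => (Measure.dirac 0 + volume.restrict (Set.Ioi 0))),
      ∀ i, 0 ≤ x i :=
    ae_all_iff.2 fun i => Measure.tendsto_eval_ae_ae.eventually ae_nonneg_dirac_add_volume
  filter_upwards [hnonneg] with x hx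
  rw [← Real.exp_sum, ← Real.exp_add]
  exact ENNReal.ofReal_le_ofReal (Real.exp_le_exp.2 (energy_le x hx))
end

section
/- Let K > 0. The function φ(λ) = 1/λ − K/(e^{λK} − 1) is strictly decreasing on (0,∞), and moreover φ(λ) → K/2 as λ → 0⁺ and φ(λ) → 0 as λ → ∞. -/
open Filter

/-- The mean of the rate-`1` exponential distribution truncated to `(0,x]`, divided by `x`. -/
noncomputable def normalizedTruncatedMean (x : ℝ) : ℝ := 1 / x - 1 / (Real.exp x - 1)

lemma truncatedMean_eq_mul_normalizedTruncatedMean {K : ℝ} (hK : K ≠ 0) (lam : ℝ) :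
    1 / lam - K / (Real.exp (lam * K) - 1) = K * normalizedTruncatedMean (lam * K) := by
  rw [normalizedTruncatedMean, mul_sub, mul_one_div, mul_one_div, div_mul_cancel_right₀ hK,
    one_div]

lemma sq_mul_exp_lt_sq_exp_sub_one {x : ℝ} (hx : 0 < x) :
    x ^ 2 * Real.exp x < (Real.exp x - 1) ^ 2 := by
  have hsinh : x / 2 < Real.sinh (x / 2) := Real.self_lt_sinh_iff.2 (half_pos hx)
  rw [Real.sinh_eq, Real.exp_neg] at hsinh
  have hexp : Real.exp x = Real.exp (x / 2) ^ 2 := by rw [← Real.exp_nat_mul]; ring_nf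
  have hpos := Real.exp_pos (x / 2)
  rw [hexp]
  have hlt : x * Real.exp (x / 2) < Real.exp (x / 2) ^ 2 - 1 := by
    calc x * Real.exp (x / 2)
        < (Real.exp (x / 2) - (Real.exp (x / 2))⁻¹) * Real.exp (x / 2) := by
          gcongr; linarith
      _ = Real.exp (x / 2) ^ 2 - 1 := by field_simp
  rw [← mul_pow]
  gcongr

lemma hasDerivAt_normalizedTruncatedMean {x : ℝ} (hx : 0 < x) :
    HasDerivAt normalizedTruncatedMean
      (Real.exp x / (Real.exp x - 1) ^ 2 - 1 / x ^ 2) x := by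
  have hne : Real.exp x - 1 ≠ 0 := (sub_pos.2 (Real.one_lt_exp_iff.2 hx)).ne'
  have h := (hasDerivAt_inv hx.ne').sub (((Real.hasDerivAt_exp x).sub_const 1).inv hne)
  refine (h.congr_deriv (by ring)).congr_of_eventuallyEq (.of_forall fun y => ?_)
  simp [normalizedTruncatedMean]

lemma strictAntiOn_normalizedTruncatedMean :
    StrictAntiOn normalizedTruncatedMean (Set.Ioi 0) := by
  refine strictAntiOn_of_deriv_neg (convex_Ioi 0)
    (fun x hx => (hasDerivAt_normalizedTruncatedMean hx).continuousAt.continuousWithinAt)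
    fun x hx => ?_
  rw [interior_Ioi, Set.mem_Ioi] at hx
  have hpos : 0 < Real.exp x - 1 := sub_pos.2 (Real.one_lt_exp_iff.2 hx)
  rw [(hasDerivAt_normalizedTruncatedMean hx).deriv, sub_neg,
    div_lt_div_iff₀ (by positivity) (by positivity)]
  linarith [sq_mul_exp_lt_sq_exp_sub_one hx]

lemma tendsto_normalizedTruncatedMean_nhdsGT_zero :
    Tendsto normalizedTruncatedMean (nhdsWithin 0 (Set.Ioi 0)) (nhds (1 / 2)) := by
  have hsecond := (Real.exp_sub_sum_range_succ_isLittleO_pow 2).tendsto_div_nhds_zero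
  have hfirst := (Real.exp_sub_sum_range_succ_isLittleO_pow 1).tendsto_div_nhds_zero
  have h := ((hsecond.add_const (1 / 2)).div (hfirst.add_const 1) (by norm_num)).mono_left
    (nhdsWithin_le_nhds (s := Set.Ioi 0))
  norm_num only at h
  refine h.congr' ?_
  filter_upwards [self_mem_nhdsWithin] with x hx
  have hx0 : x ≠ 0 := (Set.mem_Ioi.1 hx).ne'
  have hne : Real.exp x - 1 ≠ 0 := (sub_pos.2 (Real.one_lt_exp_iff.2 hx)).ne'
  have hnum : (Real.exp x - (1 + x + x ^ 2 / 2)) / x ^ 2 + 1 / 2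
      = (Real.exp x - 1 - x) / x ^ 2 := by field_simp; ring
  have hden : (Real.exp x - (1 + x)) / x + 1 = (Real.exp x - 1) / x := by field_simp; ring
  simp only [Pi.div_apply, Finset.sum_range_succ, Finset.sum_range_zero, Nat.factorial,
    normalizedTruncatedMean]
  norm_num
  norm_num at hnum
  rw [hnum, hden]
  field_simp

lemma tendsto_normalizedTruncatedMean_atTop :
    Tendsto normalizedTruncatedMean atTop (nhds 0) := by
  have hexp : Tendsto (fun x : ℝ => Real.exp x - 1) atTop atTop :=
    tendsto_atTop_add_const_right _ (-1) Real.tendsto_exp_atTop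
  unfold normalizedTruncatedMean
  simpa [Function.comp_def] using
    tendsto_inv_atTop_zero.sub (tendsto_inv_atTop_zero.comp hexp)

/-- The mean `φ(λ) = 1/λ − K/(e^{λK}−1)` of the exponential distribution of
rate `λ` truncated to `(0,K]` is strictly decreasing on `(0,∞)`, tends to
`K/2` as `λ → 0⁺` and to `0` as `λ → ∞`. -/
theorem truncated_exponential_mean_monotonicity (K : ℝ) (hK : 0 < K) :
    StrictAntiOn (fun lam : ℝ => 1 / lam - K / (Real.exp (lam * K) - 1))
      (Set.Ioi 0) ∧
    Tendsto (fun lam : ℝ => 1 / lam - K / (Real.exp (lam * K) - 1))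
      (nhdsWithin 0 (Set.Ioi 0)) (nhds (K / 2)) ∧
    Tendsto (fun lam : ℝ => 1 / lam - K / (Real.exp (lam * K) - 1))
      atTop (nhds 0) := by
  simp only [truncatedMean_eq_mul_normalizedTruncatedMean hK.ne']
  refine ⟨fun x hx y hy hxy => ?_, ?_, ?_⟩
  · exact mul_lt_mul_of_pos_left (strictAntiOn_normalizedTruncatedMean
      (mul_pos hx hK) (mul_pos hy hK) (mul_lt_mul_of_pos_right hxy hK)) hK
  · have hscale : Tendsto (fun lam : ℝ => lam * K) (nhdsWithin 0 (Set.Ioi 0))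
        (nhdsWithin 0 (Set.Ioi 0)) := by
      refine tendsto_nhdsWithin_iff.2 ⟨?_, ?_⟩
      · exact ((continuous_mul_const K).tendsto' 0 0 (zero_mul K)).mono_left nhdsWithin_le_nhds
      · filter_upwards [self_mem_nhdsWithin] with x hx using mul_pos hx hK
    simpa [div_eq_mul_inv] using
      (tendsto_normalizedTruncatedMean_nhdsGT_zero.comp hscale).const_mul K
  · simpa using (tendsto_normalizedTruncatedMean_atTop.comp
      (tendsto_id.atTop_mul_const hK)).const_mul K
end

section
/- Let K > 0, let J be a finite index set, and let reals a, b and c_j, d_j, f_j, e_j (j ∈ J) be given. For y = (y_j)_{j∈J} ∈ [0,K]^J define θ₁(y) = a + Σ_{j∈J}( c_j δ*(y_j) − d_j y_j ) and θ₂(y) = b + Σ_{j∈J}( f_j δ*(y_j) − e_j y_j ). Assume b + Σ_{j∈J} min(0, f_j, f_j − e_jK) > 0 (so that θ₂(y) > 0 for all y), and assume d_j ≤ 0 and e_j ≥ 0 for all j ∈ J. Define R(y) = (1 − γ(y)) · ( 1/θ₂(y) − K/(e^{θ₂(y)K} − 1) ) with γ(y) = θ₂(y) / ( θ₂(y) +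 e^{θ₁(y)}(1 − e^{−θ₂(y)K}) ). Then for each j₀ ∈ J and each fixed choice of y_j for j ≠ j₀, the map y_{j₀} ↦ R(y) is nondecreasing on (0,K]. -/
/-- The integral of `exp (-u x)` over the unit interval decreases with the rate `u > 0`. -/
lemma antitoneOn_one_sub_exp_neg_div :
    AntitoneOn (fun u : ℝ => (1 - Real.exp (-u)) / u) (Set.Ioi 0) := by
  have hderiv : ∀ u ∈ Set.Ioi (0 : ℝ), HasDerivAt (fun u : ℝ => (1 - Real.exp (-u)) / u)
      ((Real.exp (-u) * u - (1 - Real.exp (-u))) / u ^ 2) u := by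
    intro u hu
    have h := (((hasDerivAt_id' u).fun_neg.exp).const_sub 1).fun_div (hasDerivAt_id' u)
      (ne_of_gt hu)
    simpa only [mul_neg, mul_one, neg_neg] using h
  refine antitoneOn_of_deriv_nonpos (convex_Ioi 0)
    (fun u hu => (hderiv u hu).continuousAt.continuousWithinAt) ?_ ?_
  · rw [interior_Ioi]
    exact fun u hu => (hderiv u hu).differentiableAt.differentiableWithinAt
  · rw [interior_Ioi]
    intro u hu
    rw [(hderiv u hu).deriv]
    refine div_nonpos_of_nonpos_of_nonneg ?_ (sq_nonneg u)
    have h1 := mul_le_mul_of_nonneg_left (Real.add_one_le_exp u) (Real.exp_pos (-u)).le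
    rw [← Real.exp_add, neg_add_cancel, Real.exp_zero] at h1
    linarith

lemma sq_mul_exp_le_exp_sub_one_sq {u : ℝ} (hu : 0 ≤ u) :
    u ^ 2 * Real.exp u ≤ (Real.exp u - 1) ^ 2 := by
  have hs : u / 2 ≤ Real.sinh (u / 2) := Real.self_le_sinh_iff.2 (by positivity)
  rw [Real.sinh_eq] at hs
  have hv : Real.exp u = Real.exp (u / 2) ^ 2 := by
    rw [← Real.exp_nat_mul]
    congr 1
    push_cast
    ring
  have hinv : Real.exp (u / 2) * Real.exp (-(u / 2)) = 1 := by
    rw [← Real.exp_add, add_neg_cancel, Real.exp_zero]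
  have h1 : u * Real.exp (u / 2) ≤ Real.exp u - 1 := by
    have := mul_le_mul_of_nonneg_left hs (Real.exp_pos (u / 2)).le
    nlinarith
  calc u ^ 2 * Real.exp u = (u * Real.exp (u / 2)) ^ 2 := by rw [hv]; ring
    _ ≤ _ := pow_le_pow_left₀ (by positivity) h1 2

/-- The mean of the exponential law truncated to the unit interval decreases with its
rate `u > 0`. -/
lemma antitoneOn_one_div_sub_one_div_exp_sub_one :
    AntitoneOn (fun u : ℝ => 1 / u - 1 / (Real.exp u - 1)) (Set.Ioi 0) := by
  have hpos : ∀ u ∈ Set.Ioi (0 : ℝ), 0 < Real.exp u - 1 := fun u hu =>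
    sub_pos.2 (Real.one_lt_exp_iff.2 hu)
  have hderiv : ∀ u ∈ Set.Ioi (0 : ℝ),
      HasDerivAt (fun u : ℝ => 1 / u - 1 / (Real.exp u - 1))
        (-1 / u ^ 2 - -Real.exp u / (Real.exp u - 1) ^ 2) u := by
    intro u hu
    have h := (hasDerivAt_id' u).fun_inv (ne_of_gt hu) |>.fun_sub
      (((Real.hasDerivAt_exp u).sub_const 1).fun_inv (hpos u hu).ne')
    simpa only [one_div] using h
  refine antitoneOn_of_deriv_nonpos (convex_Ioi 0)
    (fun u hu => (hderiv u hu).continuousAt.continuousWithinAt) ?_ ?_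
  · rw [interior_Ioi]
    exact fun u hu => (hderiv u hu).differentiableAt.differentiableWithinAt
  · rw [interior_Ioi]
    intro u hu
    rw [(hderiv u hu).deriv]
    have hu' : 0 < u := hu
    have h : Real.exp u / (Real.exp u - 1) ^ 2 ≤ 1 / u ^ 2 := by
      rw [div_le_div_iff₀ (pow_pos (hpos u hu) 2) (by positivity)]
      linarith [sq_mul_exp_le_exp_sub_one_sq hu'.le]
    rw [neg_div, neg_div]
    linarith

lemma one_div_sub_one_div_exp_sub_one_nonneg {u : ℝ} (hu : 0 < u) :
    0 ≤ 1 / u - 1 / (Real.exp u - 1) :=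
  sub_nonneg.2 (one_div_le_one_div_of_le hu (by linarith [Real.add_one_le_exp u]))

/-- The mean of the mixed truncated exponential law increases with `θ₁` and decreases with
`θ₂ > 0`. -/
lemma mixed_truncated_exponential_mean_le {K s₁ s₂ t₁ t₂ : ℝ} (hK : 0 < K)
    (ht₂ : 0 < t₂) (h₁ : s₁ ≤ t₁) (h₂ : t₂ ≤ s₂) :
    (1 - s₂ / (s₂ + Real.exp s₁ * (1 - Real.exp (-s₂ * K)))) *
        (1 / s₂ - K / (Real.exp (s₂ * K) - 1)) ≤
      (1 - t₂ / (t₂ + Real.exp t₁ * (1 - Real.exp (-t₂ * K)))) *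
        (1 / t₂ - K / (Real.exp (t₂ * K) - 1)) := by
  have hs₂ : 0 < s₂ := ht₂.trans_le h₂
  have hu : t₂ * K ≤ s₂ * K := mul_le_mul_of_nonneg_right h₂ hK.le
  have hone : ∀ x : ℝ, 0 < x → 0 < 1 - Real.exp (-x * K) := fun x hx =>
    sub_pos.2 (Real.exp_lt_one_iff.2 (by nlinarith [mul_pos hx hK]))
  have hmean : ∀ x : ℝ, 0 < x → 1 / x - K / (Real.exp (x * K) - 1) =
      K * (1 / (x * K) - 1 / (Real.exp (x * K) - 1)) := by
    intro x hx
    field_simp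
  have hmass : (1 - Real.exp (-s₂ * K)) / s₂ ≤ (1 - Real.exp (-t₂ * K)) / t₂ := by
    have h := antitoneOn_one_sub_exp_neg_div (Set.mem_Ioi.2 (mul_pos ht₂ hK))
      (Set.mem_Ioi.2 (mul_pos hs₂ hK)) hu
    simp only [← neg_mul, ← div_div] at h
    exact (div_le_div_iff_of_pos_right hK).1 h
  have hweight : Real.exp s₁ * (1 - Real.exp (-s₂ * K)) * t₂ ≤
      Real.exp t₁ * (1 - Real.exp (-t₂ * K)) * s₂ := by
    rw [div_le_div_iff₀ hs₂ ht₂] at hmass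
    rw [mul_assoc, mul_assoc]
    exact mul_le_mul (Real.exp_le_exp.2 h₁) hmass
      (mul_pos (hone s₂ hs₂) ht₂).le (Real.exp_pos _).le
  have hS := mul_pos (Real.exp_pos s₁) (hone s₂ hs₂)
  have hT := mul_pos (Real.exp_pos t₁) (hone t₂ ht₂)
  rw [hmean s₂ hs₂, hmean t₂ ht₂]
  refine mul_le_mul (sub_le_sub_left ?_ 1) (mul_le_mul_of_nonneg_left ?_ hK.le)
    (mul_nonneg hK.le (one_div_sub_one_div_exp_sub_one_nonneg (mul_pos hs₂ hK)))
    (sub_nonneg.2 (div_le_one_of_le₀ (by linarith) (by linarith)))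
  · rw [div_le_div_iff₀ (by linarith) (by linarith)]
    linarith
  · exact antitoneOn_one_div_sub_one_div_exp_sub_one (Set.mem_Ioi.2 (mul_pos ht₂ hK))
      (Set.mem_Ioi.2 (mul_pos hs₂ hK)) hu

lemma min_le_mul_dstar_sub_mul {K f e x : ℝ} (he : 0 ≤ e) (hx : x ≤ K) :
    min (min 0 f) (f - e * K) ≤ f * dstar x - e * x := by
  by_cases h : x = 0
  · simp [h, dstar]
  · refine (min_le_right _ _).trans ?_
    simp only [dstar, h, if_false, mul_one]
    linarith [mul_le_mul_of_nonneg_left hx he]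

/-- Spatial cooperation of the mixed truncated exponential auto-model: under
Assumption 4 (`b + Σ_j min(0, f_j, f_j − e_jK) > 0`) and Assumption 5
(`d_j ≤ 0`, `e_j ≥ 0`), the conditional expectation
`R(y) = (1−γ(y))(1/θ₂(y) − K/(e^{θ₂(y)K}−1))` is nondecreasing in each
neighbouring coordinate `y_{j₀} ∈ (0,K]`. -/
theorem mixed_truncated_exponential_automodel_cooperative
    (K : ℝ) (hK : 0 < K) {J : Type*} [Fintype J] [DecidableEq J]
    (a b : ℝ) (c d f e : J → ℝ)
    (hA4 : 0 < b + ∑ j, min (min 0 (f j)) (f j - e j * K))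
    (hd : ∀ j, d j ≤ 0) (he : ∀ j, 0 ≤ e j)
    (θ₁ θ₂ : (J → ℝ) → ℝ)
    (hθ₁ : ∀ y : J → ℝ, θ₁ y = a + ∑ j, (c j * dstar (y j) - d j * y j))
    (hθ₂ : ∀ y : J → ℝ, θ₂ y = b + ∑ j, (f j * dstar (y j) - e j * y j))
    (γ R : (J → ℝ) → ℝ)
    (hγ : ∀ y : J → ℝ,
      γ y = θ₂ y / (θ₂ y + Real.exp (θ₁ y) * (1 - Real.exp (-(θ₂ y) * K))))
    (hR : ∀ y : J → ℝ,
      R y = (1 - γ y) * (1 / θ₂ y - K / (Real.exp (θ₂ y * K) - 1)))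
    (j₀ : J) (y : J → ℝ) (hy : ∀ j, y j ∈ Set.Icc (0 : ℝ) K) :
    MonotoneOn (fun t : ℝ => R (Function.update y j₀ t)) (Set.Ioc 0 K) := by
  intro s hs t ht hst
  have hdstar : dstar s = dstar t := by simp [dstar, hs.1.ne', ht.1.ne']
  simp only [hR, hγ]
  refine mixed_truncated_exponential_mean_le hK ?_ ?_ ?_
  · rw [hθ₂]
    refine hA4.trans_le (add_le_add_right (Finset.sum_le_sum fun j _ => ?_) b)
    refine min_le_mul_dstar_sub_mul (he j) ?_
    rcases eq_or_ne j j₀ with rfl | hj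
    · simpa using ht.2
    · simpa [hj] using (hy j).2
  · rw [hθ₁, hθ₁]
    refine add_le_add_right (Finset.sum_le_sum fun j _ => ?_) a
    rcases eq_or_ne j j₀ with rfl | hj
    · simp only [Function.update_self, hdstar]
      linarith [mul_le_mul_of_nonpos_left hst (hd j)]
    · simp [hj]
  · rw [hθ₂, hθ₂]
    refine add_le_add_right (Finset.sum_le_sum fun j _ => ?_) b
    rcases eq_or_ne j j₀ with rfl | hj
    · simp only [Function.update_self, hdstar]
      linarith [mul_le_mul_of_nonneg_left hst (he j)]
    · simp [hj]
end

section
/- Let K > 0, let J be a finite index set, and let reals a, b and c_j, d_j, f_j, e_j (j ∈ J) be given. For y = (y_j)_{j∈J} ∈ [0,K]^J define θ₁(y) = a + Σ_{j∈J}( c_j δ*(y_j) − d_j y_j ) and θ₂(y) = b + Σ_{j∈J}( f_j δ*(y_j) − e_j y_j ). Assume b + Σ_{j∈J} min(0, f_j, f_j − e_jK) > 0 (so that θ₂(y) > 0 for all y), and assume d_j ≥ 0 and e_j ≤ 0 for all j ∈ J. Define R(y) = (1 − γ(y)) · ( 1/θ₂(y) − K/(e^{θ₂(y)K} − 1) )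 with γ(y) = θ₂(y) / ( θ₂(y) + e^{θ₁(y)}(1 − e^{−θ₂(y)K}) ). Then for each j₀ ∈ J and each fixed choice of y_j for j ≠ j₀, the map y_{j₀} ↦ R(y) is nonincreasing on (0,K]. -/
open Real Set in
/-- The mean `1 / x - 1 / (eˣ - 1)` of the exponential law of rate `x` truncated to `[0, 1]` is
antitone in the rate. -/
theorem antitoneOn_one_div_sub_one_div_exp_sub_one_s11 :
    AntitoneOn (fun x : ℝ => 1 / x - 1 / (exp x - 1)) (Ioi 0) := by
  have hne : ∀ x ∈ Ioi (0 : ℝ), 0 < exp x - 1 := fun x hx => by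
    simpa using one_lt_exp_iff.2 hx
  have hderiv : ∀ x ∈ Ioi (0 : ℝ), HasDerivAt (fun x : ℝ => 1 / x - 1 / (exp x - 1))
      (-(x ^ 2)⁻¹ + exp x / (exp x - 1) ^ 2) x := fun x hx => by
    have h₁ := hasDerivAt_inv (ne_of_gt (mem_Ioi.1 hx))
    have h₂ := ((hasDerivAt_exp x).sub_const 1).inv (hne x hx).ne'
    exact ((h₁.sub h₂).congr_deriv (by ring)).congr_of_eventuallyEq (.of_forall fun z => by simp)
  refine antitoneOn_of_deriv_nonpos (convex_Ioi 0)
    (fun x hx => (hderiv x hx).continuousAt.continuousWithinAt)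
    (fun x hx => (hderiv x (interior_subset hx)).differentiableAt.differentiableWithinAt)
    fun x hx => ?_
  replace hx := interior_subset hx
  have hx0 : 0 < x := hx
  rw [(hderiv x hx).deriv]
  have hsinh : x / 2 ≤ sinh (x / 2) := self_le_sinh_iff.2 (by positivity)
  rw [sinh_eq, exp_neg] at hsinh
  have hu : 0 < exp (x / 2) := exp_pos _
  have hsq : exp x = exp (x / 2) ^ 2 := by
    rw [← exp_nat_mul]
    congr 1
    push_cast
    ring
  have hle : x * exp (x / 2) ≤ exp x - 1 := by
    have := mul_le_mul_of_nonneg_right hsinh hu.le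
    have hinv : (exp (x / 2))⁻¹ * exp (x / 2) = 1 := inv_mul_cancel₀ hu.ne'
    rw [hsq]
    linear_combination 2 * this - hinv
  have hle' : x ^ 2 * exp x ≤ (exp x - 1) ^ 2 := by
    have := pow_le_pow_left₀ (by positivity) hle 2
    rwa [mul_pow, ← hsq] at this
  have : exp x / (exp x - 1) ^ 2 ≤ (x ^ 2)⁻¹ := by
    rw [div_le_iff₀ (pow_pos (hne x hx) 2), ← div_eq_inv_mul, le_div_iff₀ (by positivity)]
    linarith
  linarith

open Real Set in
theorem antitoneOn_one_sub_exp_neg_div_s11 :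
    AntitoneOn (fun x : ℝ => (1 - exp (-x)) / x) (Ioi 0) := by
  intro x hx y hy hxy
  have h := convexOn_exp.secant_mono (mem_univ 0) (mem_univ (-y)) (mem_univ (-x))
    (neg_ne_zero.2 (ne_of_gt hy)) (neg_ne_zero.2 (ne_of_gt hx)) (neg_le_neg hxy)
  simp only [exp_zero, sub_zero, div_neg, ← neg_div, neg_sub] at h
  exact h

open Real in
/-- The mean of the law with an atom at `0` and a truncated exponential part on `(0, K]` is
nondecreasing in the first natural parameter and nonincreasing in the second. -/
theorem mixed_truncated_exponential_mean_le_s11 {K p p' v v' : ℝ} (hK : 0 < K) (hv : 0 < v)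
    (hvv : v ≤ v') (hp : p' ≤ p) :
    (1 - v' / (v' + exp p' * (1 - exp (-v' * K)))) * (1 / v' - K / (exp (v' * K) - 1)) ≤
      (1 - v / (v + exp p * (1 - exp (-v * K)))) * (1 / v - K / (exp (v * K) - 1)) := by
  have hv' : 0 < v' := hv.trans_le hvv
  have hmono : v * K ≤ v' * K := mul_le_mul_of_nonneg_right hvv hK.le
  have hg : (1 - exp (-v' * K)) / v' ≤ (1 - exp (-v * K)) / v := by
    have h := antitoneOn_one_sub_exp_neg_div_s11 (mul_pos hv hK) (mul_pos hv' hK) hmono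
    simp only [← div_div, ← neg_mul] at h
    exact (div_le_div_iff_of_pos_right hK).1 h
  have hexp : ∀ u : ℝ, 0 < u → 0 < 1 - exp (-u * K) := fun u hu => by
    have : -u * K < 0 := by nlinarith
    linarith [exp_lt_one_iff.2 this]
  have hscale : ∀ u : ℝ, 0 < u →
      1 / u - K / (exp (u * K) - 1) = K * (1 / (u * K) - 1 / (exp (u * K) - 1)) := fun u hu => by
    rw [mul_sub, mul_one_div, mul_one_div]
    congr 1
    field_simp
  have hh : 1 / v' - K / (exp (v' * K) - 1) ≤ 1 / v - K / (exp (v * K) - 1) := by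
    rw [hscale v hv, hscale v' hv']
    exact mul_le_mul_of_nonneg_left (antitoneOn_one_div_sub_one_div_exp_sub_one_s11
      (mul_pos hv hK) (mul_pos hv' hK) hmono) hK.le
  have hh0 : 0 ≤ 1 / v' - K / (exp (v' * K) - 1) := by
    rw [hscale v' hv']
    have := add_one_le_exp (v' * K)
    exact mul_nonneg hK.le (sub_nonneg.2
      (one_div_le_one_div_of_le (mul_pos hv' hK) (by linarith)))
  have hodds : ∀ q u : ℝ, 0 < u → 1 - u / (u + exp q * (1 - exp (-u * K))) =
      1 - 1 / (1 + exp q * ((1 - exp (-u * K)) / u)) := fun q u hu => by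
    have h₁ : 0 < u + exp q * (1 - exp (-u * K)) :=
      add_pos hu (mul_pos (exp_pos q) (hexp u hu))
    congr 1
    field_simp
  have hg0 : ∀ u : ℝ, 0 < u → 0 < (1 - exp (-u * K)) / u := fun u hu => div_pos (hexp u hu) hu
  have hw : exp p' * ((1 - exp (-v' * K)) / v') ≤ exp p * ((1 - exp (-v * K)) / v) :=
    mul_le_mul (exp_le_exp.2 hp) hg (hg0 v' hv').le (exp_pos p).le
  have hw0 : 0 < exp p' * ((1 - exp (-v' * K)) / v') := mul_pos (exp_pos p') (hg0 v' hv')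
  rw [hodds p v hv, hodds p' v' hv']
  refine mul_le_mul (sub_le_sub_left (one_div_le_one_div_of_le (by linarith) (by linarith)) 1)
    hh hh0 (sub_nonneg.2 ?_)
  exact (div_le_one (by linarith)).2 (by linarith)

/-- Spatial competition of the mixed truncated exponential auto-model: under
Assumption 4 (`b + Σ_j min(0, f_j, f_j − e_jK) > 0`) and Assumption 6
(`d_j ≥ 0`, `e_j ≤ 0`), the conditional expectation
`R(y) = (1−γ(y))(1/θ₂(y) − K/(e^{θ₂(y)K}−1))` is nonincreasing in each
neighbouring coordinate `y_{j₀} ∈ (0,K]`. -/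
theorem mixed_truncated_exponential_automodel_competitive
    (K : ℝ) (hK : 0 < K) {J : Type*} [Fintype J] [DecidableEq J]
    (a b : ℝ) (c d f e : J → ℝ)
    (hA4 : 0 < b + ∑ j, min (min 0 (f j)) (f j - e j * K))
    (hd : ∀ j, 0 ≤ d j) (he : ∀ j, e j ≤ 0)
    (θ₁ θ₂ : (J → ℝ) → ℝ)
    (hθ₁ : ∀ y : J → ℝ, θ₁ y = a + ∑ j, (c j * dstar (y j) - d j * y j))
    (hθ₂ : ∀ y : J → ℝ, θ₂ y = b + ∑ j, (f j * dstar (y j) - e j * y j))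
    (γ R : (J → ℝ) → ℝ)
    (hγ : ∀ y : J → ℝ,
      γ y = θ₂ y / (θ₂ y + Real.exp (θ₁ y) * (1 - Real.exp (-(θ₂ y) * K))))
    (hR : ∀ y : J → ℝ,
      R y = (1 - γ y) * (1 / θ₂ y - K / (Real.exp (θ₂ y * K) - 1)))
    (j₀ : J) (y : J → ℝ) (hy : ∀ j, y j ∈ Set.Icc (0 : ℝ) K) :
    AntitoneOn (fun t : ℝ => R (Function.update y j₀ t)) (Set.Ioc 0 K) := by
  intro s hs t ht hst
  have hmem : ∀ j, Function.update y j₀ s j ∈ Set.Icc (0 : ℝ) K := fun j => by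
    rcases eq_or_ne j j₀ with rfl | hj
    · simpa using ⟨hs.1.le, hs.2⟩
    · simpa [hj] using hy j
  have hpos : 0 < θ₂ (Function.update y j₀ s) := by
    rw [hθ₂]
    refine hA4.trans_le (add_le_add_right (Finset.sum_le_sum fun j _ => ?_) b)
    obtain ⟨h0, -⟩ := hmem j
    by_cases hz : Function.update y j₀ s j = 0
    · simp [dstar, hz]
    · simp only [dstar, hz, if_false, mul_one]
      have := mul_nonpos_of_nonpos_of_nonneg (he j) h0
      exact (min_le_left _ _).trans ((min_le_right _ _).trans (by linarith))
  have hstar : dstar s = dstar t := by simp [dstar, hs.1.ne', ht.1.ne']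
  have hle₂ : θ₂ (Function.update y j₀ s) ≤ θ₂ (Function.update y j₀ t) := by
    rw [hθ₂, hθ₂]
    refine add_le_add_right (Finset.sum_le_sum fun j _ => ?_) b
    rcases eq_or_ne j j₀ with rfl | hj
    · have := mul_le_mul_of_nonpos_left hst (he j)
      simp only [Function.update_self, hstar]
      linarith
    · simp [hj]
  have hle₁ : θ₁ (Function.update y j₀ t) ≤ θ₁ (Function.update y j₀ s) := by
    rw [hθ₁, hθ₁]
    refine add_le_add_right (Finset.sum_le_sum fun j _ => ?_) a
    rcases eq_or_ne j j₀ with rfl | hj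
    · have := mul_le_mul_of_nonneg_left hst (hd j)
      simp only [Function.update_self, hstar]
      linarith
    · simp [hj]
  simp only [hR, hγ]
  exact mixed_truncated_exponential_mean_le_s11 hK hpos hle₂ hle₁
end

section
/- Let K > 0 and define g(u, t) = ( 1/(1 + e^{u}) ) · ( (1 − e^{−tK}) / t ) for u ∈ ℝ and t > 0. Then for each fixed t > 0 the map u ↦ g(u,t) is strictly decreasing on ℝ, and for each fixed u ∈ ℝ the map t ↦ g(u,t) is strictly decreasing on (0,∞). Consequently, if θ₁, θ₃ : ℝ → ℝ are such that θ₃ > 0 everywhere and both θ₃ and θ₁ − θ₃K are nonincreasing, then η ↦ g( θ₁(η) − θ₃(η)K, θ₃(η) ) is nondecreasing. -/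
/-- The secant slope `(1 - exp (-t * K)) / t` is strictly decreasing in `t > 0`. -/
lemma strictAntiOn_one_sub_exp_neg_mul_div {K : ℝ} (hK : 0 < K) :
    StrictAntiOn (fun t : ℝ => (1 - Real.exp (-t * K)) / t) (Set.Ioi 0) := by
  intro s hs t ht hst
  rw [Set.mem_Ioi] at hs ht
  have h := strictConvexOn_exp.secant_strict_mono (a := 0) (x := -t * K) (y := -s * K)
    (Set.mem_univ _) (Set.mem_univ _) (Set.mem_univ _)
    (by nlinarith [mul_pos ht hK]) (by nlinarith [mul_pos hs hK])
    (by nlinarith [mul_pos (sub_pos.2 hst) hK])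
  have slope_eq : ∀ r : ℝ, 0 < r → (Real.exp (-r * K) - Real.exp 0) / (-r * K - 0)
      = (1 - Real.exp (-r * K)) / r / K := by
    intro r hr
    rw [Real.exp_zero, sub_zero, div_div, neg_mul, div_neg, ← neg_div, neg_sub]
  rw [slope_eq t ht, slope_eq s hs] at h
  exact (div_lt_div_iff_of_pos_right hK).1 h

lemma one_sub_exp_neg_mul_div_pos {K t : ℝ} (hK : 0 < K) (ht : 0 < t) :
    0 < (1 - Real.exp (-t * K)) / t :=
  div_pos (sub_pos.2 (Real.exp_lt_one_iff.2 (by nlinarith [mul_pos ht hK]))) ht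

/-- Monotonicity of `g(u,t) = (1/(1+e^u))·((1−e^{−tK})/t)`, the mean of the
mixed censored exponential distribution in terms of `u = θ₁ − θ₃K` and
`t = θ₃`: it is strictly decreasing in `u` (for each `t > 0`) and strictly
decreasing in `t` on `(0,∞)` (for each `u`).  Consequently, if `θ₃ > 0`
everywhere and both `θ₃` and `θ₁ − θ₃K` are nonincreasing in a real parameter
`η`, then `η ↦ g(θ₁(η) − θ₃(η)K, θ₃(η))` is nondecreasing. -/
theorem mixed_censored_exponential_mean_monotonicity
    (K : ℝ) (hK : 0 < K)
    (g : ℝ → ℝ → ℝ)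
    (hg : ∀ u t : ℝ, g u t
      = (1 / (1 + Real.exp u)) * ((1 - Real.exp (-t * K)) / t)) :
    (∀ t : ℝ, 0 < t → StrictAnti (fun u => g u t)) ∧
    (∀ u : ℝ, StrictAntiOn (fun t => g u t) (Set.Ioi 0)) ∧
    (∀ θ₁ θ₃ : ℝ → ℝ, (∀ η, 0 < θ₃ η) → Antitone θ₃ →
      Antitone (fun η => θ₁ η - θ₃ η * K) →
      Monotone (fun η => g (θ₁ η - θ₃ η * K) (θ₃ η))) := by
  have anti_left : ∀ t : ℝ, 0 < t → StrictAnti (fun u => g u t) := by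
    intro t ht u v huv
    simp only [hg]
    refine mul_lt_mul_of_pos_right ?_ (one_sub_exp_neg_mul_div_pos hK ht)
    exact one_div_lt_one_div_of_lt (by positivity) (by gcongr)
  have anti_right : ∀ u : ℝ, StrictAntiOn (fun t => g u t) (Set.Ioi 0) := by
    intro u s hs t ht hst
    simp only [hg]
    exact mul_lt_mul_of_pos_left (strictAntiOn_one_sub_exp_neg_mul_div hK hs ht hst)
      (by positivity)
  refine ⟨anti_left, anti_right, fun θ₁ θ₃ hpos hθ₃ hu η η' hη => ?_⟩
  calc g (θ₁ η - θ₃ η * K) (θ₃ η)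
      ≤ g (θ₁ η' - θ₃ η' * K) (θ₃ η) := (anti_left _ (hpos η)).antitone (hu hη)
    _ ≤ g (θ₁ η' - θ₃ η' * K) (θ₃ η') :=
      (anti_right _).antitoneOn (hpos η') (hpos η) (hθ₃ hη)
end

section
/- Let K > 0, let J be a finite index set, and let reals r, b and s_j, u_j, t_j, d_j, e_j (j ∈ J) be given. For y = (y_j)_{j∈J} ∈ [0,K]^J define θ₁(y) = r + Σ_{j∈J}( s_j 1_{{0}}(y_j) + u_j 1_{(0,K)}(y_j) − t_j y_j 1_{(0,K)}(y_j) ) and θ₃(y) = b + Σ_{j∈J}( t_j 1_{{0}}(y_j) + d_j 1_{(0,K)}(y_j) − e_j y_j 1_{(0,K)}(y_j) ). Assume Assumption 7: b + Σ_{j∈J} min( t_j, d_j, d_j − e_jK ) > 0 (so that θ₃(y) > 0 for all y), and Assumption 9: e_j ≤ 0 and t_j − e_jK ≤ 0 for all j ∈ J. Define R(y) = ( 1/(1 + e^{θ₁(y)−θ₃(y)K}) ) · ( (1 − e^{−θ₃(y)K}) / θ₃(y) ). Then for each j₀ ∈ J and each fixed choice of y_j for j ≠ j₀, the map y_{j₀}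 ↦ R(y) is nonincreasing on (0,K). -/
/-- The secant slope `(1 - exp (-x K)) / x` of the exponential is nonincreasing in `x > 0`. -/
lemma one_sub_exp_neg_mul_div_antitoneOn (K : ℝ) :
    AntitoneOn (fun x : ℝ => (1 - Real.exp (-x * K)) / x) (Set.Ioi 0) := by
  intro x hx y hy hxy
  rw [Set.mem_Ioi] at hx hy
  have h := convexOn_exp.2 (Set.mem_univ (-y * K)) (Set.mem_univ 0)
    (div_nonneg hx.le hy.le) (sub_nonneg.2 ((div_le_one hy).2 hxy)) (by ring)
  have harg : (x / y) • (-y * K) + (1 - x / y) • (0 : ℝ) = -x * K := by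
    simp only [smul_eq_mul]
    field_simp
    ring
  rw [harg, Real.exp_zero, smul_eq_mul, smul_eq_mul] at h
  have hslope : x * ((1 - Real.exp (-y * K)) / y) ≤ 1 - Real.exp (-x * K) := by
    have : x * ((1 - Real.exp (-y * K)) / y) = x / y - x / y * Real.exp (-y * K) := by ring
    linarith
  rw [le_div_iff₀ hx]
  linarith

/-- Spatial competition of the mixed censored exponential auto-model: under
Assumption 7 (`b + Σ_j min(t_j, d_j, d_j − e_jK) > 0`) and Assumption 9
(`e_j ≤ 0`, `t_j − e_jK ≤ 0`), the conditional expectation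
`R(y) = (1/(1+e^{θ₁(y)−θ₃(y)K}))·(1−e^{−θ₃(y)K})/θ₃(y)` is nonincreasing in
each neighbouring coordinate `y_{j₀} ∈ (0,K)`. -/
theorem mixed_censored_exponential_automodel_competitive
    (K : ℝ) (hK : 0 < K) {J : Type*} [Fintype J] [DecidableEq J]
    (r b : ℝ) (s u t d e : J → ℝ)
    (hA7 : 0 < b + ∑ j, min (min (t j) (d j)) (d j - e j * K))
    (he : ∀ j, e j ≤ 0) (hte : ∀ j, t j - e j * K ≤ 0)
    (θ₁ θ₃ : (J → ℝ) → ℝ)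
    (hθ₁ : ∀ y : J → ℝ, θ₁ y
      = r + ∑ j, (s j * Set.indicator ({0} : Set ℝ) 1 (y j)
          + u j * Set.indicator (Set.Ioo (0 : ℝ) K) 1 (y j)
          - t j * (y j * Set.indicator (Set.Ioo (0 : ℝ) K) 1 (y j))))
    (hθ₃ : ∀ y : J → ℝ, θ₃ y
      = b + ∑ j, (t j * Set.indicator ({0} : Set ℝ) 1 (y j)
          + d j * Set.indicator (Set.Ioo (0 : ℝ) K) 1 (y j)
          - e j * (y j * Set.indicator (Set.Ioo (0 : ℝ) K) 1 (y j))))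
    (R : (J → ℝ) → ℝ)
    (hR : ∀ y : J → ℝ, R y
      = (1 / (1 + Real.exp (θ₁ y - θ₃ y * K)))
        * ((1 - Real.exp (-(θ₃ y) * K)) / θ₃ y))
    (j₀ : J) (y : J → ℝ) (hy : ∀ j, y j ∈ Set.Icc (0 : ℝ) K) :
    AntitoneOn (fun z : ℝ => R (Function.update y j₀ z)) (Set.Ioo 0 K) := by
  have hpos : ∀ y : J → ℝ, (∀ j, y j ∈ Set.Icc (0 : ℝ) K) → 0 < θ₃ y := by
    intro y hy
    rw [hθ₃]
    refine hA7.trans_le (add_le_add_right (Finset.sum_le_sum fun j _ => ?_) b)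
    have h₁ : min (min (t j) (d j)) (d j - e j * K) ≤ t j :=
      (min_le_left _ _).trans (min_le_left _ _)
    have h₂ : min (min (t j) (d j)) (d j - e j * K) ≤ d j :=
      (min_le_left _ _).trans (min_le_right _ _)
    obtain ⟨hy₀, hyK⟩ := hy j
    rcases hy₀.eq_or_lt with h | h
    · simp [← h]
    rcases hyK.eq_or_lt with h' | h'
    · have : t j ≤ 0 := by nlinarith [he j, hte j]
      simpa [h', hK.ne'] using h₁.trans this
    · have : 0 ≤ -e j * y j := mul_nonneg (neg_nonneg.2 (he j)) hy₀
      have hmem : y j ∈ Set.Ioo 0 K := ⟨h, h'⟩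
      simp only [Set.indicator_of_mem hmem, Set.indicator_of_notMem
        (show y j ∉ ({0} : Set ℝ) from h.ne'), Pi.one_apply]
      linarith
  intro z hz w hw hzw
  have hupd : ∀ x ∈ Set.Ioo 0 K, ∀ j, Function.update y j₀ x j ∈ Set.Icc (0 : ℝ) K := by
    intro x hx j
    rcases eq_or_ne j j₀ with rfl | hj
    · simpa using Set.Ioo_subset_Icc_self hx
    · simpa [hj] using hy j
  have hz₀ : z ∉ ({0} : Set ℝ) := hz.1.ne'
  have hw₀ : w ∉ ({0} : Set ℝ) := hw.1.ne'
  have hθ₃_mono : θ₃ (Function.update y j₀ z) ≤ θ₃ (Function.update y j₀ w) := by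
    rw [hθ₃, hθ₃]
    refine add_le_add_right (Finset.sum_le_sum fun j _ => ?_) b
    rcases eq_or_ne j j₀ with rfl | hj
    · simp only [Function.update_self, Set.indicator_of_mem hz, Set.indicator_of_mem hw,
        Set.indicator_of_notMem hz₀, Set.indicator_of_notMem hw₀, Pi.one_apply]
      nlinarith [he j]
    · simp [hj]
  have hlogit_mono : θ₁ (Function.update y j₀ z) - θ₃ (Function.update y j₀ z) * K
      ≤ θ₁ (Function.update y j₀ w) - θ₃ (Function.update y j₀ w) * K := by
    simp only [hθ₁, hθ₃, add_mul, Finset.sum_mul, add_sub_add_comm, ← Finset.sum_sub_distrib]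
    refine add_le_add_right (Finset.sum_le_sum fun j _ => ?_) _
    rcases eq_or_ne j j₀ with rfl | hj
    · simp only [Function.update_self, Set.indicator_of_mem hz, Set.indicator_of_mem hw,
        Set.indicator_of_notMem hz₀, Set.indicator_of_notMem hw₀, Pi.one_apply]
      nlinarith [mul_nonneg (sub_nonneg.2 hzw) (neg_nonneg.2 (hte j))]
    · simp [hj]
  have hz_pos := hpos _ (hupd z hz)
  have hw_pos := hpos _ (hupd w hw)
  simp only [hR]
  refine mul_le_mul ?_ (one_sub_exp_neg_mul_div_antitoneOn K hz_pos hw_pos hθ₃_mono) ?_ ?_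
  · gcongr
  · refine div_nonneg (sub_nonneg.2 (Real.exp_le_one_iff.2 ?_)) hw_pos.le
    nlinarith
  · positivity
end
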